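/- For all a, b ∈ {0,…,7} and every twice continuously differentiable function f : ℝ⁸ × ℝ⁷ → ℝ, the commutator of the vector fields X_a and X_b satisfies X_a(X_b f) − X_b(X_a f) = 4 Σ_{β=1}^{7} (E^β)_{ab} ∂f/∂t_β. -/

import Mathlib

open scoped BigOperators
open Matrix

noncomputable section

namespace OC

/-- Octonions, identified with ℝ⁸. -/
abbrev Octo : Type := Fin 8 → ℝ

/-- The seven positively-oriented triples Ω. -/
def OmegaT : List (Fin 8 × Fin 8 × Fin 8) :=
  [(1,2,3),(2,4,6),(4,3,5),(3,6,7),(6,5,1),(5,7,2),(7,1,4)]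

/-- The six permutations of a triple, with their signs. -/
def signedPerms3 (t : Fin 8 × Fin 8 × Fin 8) : List (ℝ × (Fin 8 × Fin 8 × Fin 8)) :=
  [(1,(t.1,t.2.1,t.2.2)), (1,(t.2.1,t.2.2,t.1)), (1,(t.2.2,t.1,t.2.1)),
   (-1,(t.2.1,t.1,t.2.2)), (-1,(t.1,t.2.2,t.2.1)), (-1,(t.2.2,t.2.1,t.1))]

/-- The totally antisymmetric symbol ε with ε(α,β,γ) = 1 on Ω and vanishing on triples
that are not permutations of a triple of Ω. -/
def eps (a b c : Fin 8) : ℝ :=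
  (((OmegaT.map signedPerms3).flatten).map (fun p => if p.2 = (a,b,c) then p.1 else 0)).sum

/-- Coefficient of `e d` in the product `e a * e b`: `e 0` is a two-sided unit and
`e α * e β = -δ_{αβ} e 0 + ∑ γ, ε(α,β,γ) e γ` for imaginary indices. -/
def mulCoef (a b d : Fin 8) : ℝ :=
  if a = 0 then (if d = b then 1 else 0)
  else if b = 0 then (if d = a then 1 else 0)
  else (if a = b ∧ d = 0 then -1 else 0) + eps a b d

/-- Octonion multiplication on ℝ⁸. -/
def omul (x y : Octo) : Octo := fun d => ∑ a, ∑ b, x a * y b * mulCoef a b d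

/-- The standard basis octonions e₀,…,e₇. -/
def e (a : Fin 8) : Octo := fun d => if d = a then 1 else 0

/-- Real part. -/
def reO (x : Octo) : ℝ := x 0

/-- Imaginary part. -/
def imO (x : Octo) : Octo := fun d => if d = 0 then 0 else x d

/-- Octonion conjugation. -/
def conjO (x : Octo) : Octo := fun d => if d = 0 then x 0 else -x d

/-- Squared Euclidean norm |x|². -/
def normSq (x : Octo) : ℝ := ∑ a, (x a)^2

/-- Inverse of a nonzero octonion, q⁻¹ = q̄ / |q|². -/
def oinv (q : Octo) : Octo := (normSq q)⁻¹ • conjO q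

/-- The seven quadruples Λ. -/
def LambdaT : List (Fin 8 × Fin 8 × Fin 8 × Fin 8) :=
  [(5,4,6,7),(7,3,5,1),(1,6,7,2),(2,5,1,4),(4,7,2,3),(3,1,4,6),(6,2,5,3)]

/-- The 24 permutations of a quadruple, with their signs. -/
def signedPerms4 (t : Fin 8 × Fin 8 × Fin 8 × Fin 8) :
    List (ℝ × (Fin 8 × Fin 8 × Fin 8 × Fin 8)) :=
  let a := t.1; let b := t.2.1; let c := t.2.2.1; let d := t.2.2.2
  [ (1,(a,b,c,d)), (-1,(a,b,d,c)), (-1,(a,c,b,d)), (1,(a,c,d,b)), (1,(a,d,b,c)), (-1,(a,d,c,b)),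
    (-1,(b,a,c,d)), (1,(b,a,d,c)), (1,(b,c,a,d)), (-1,(b,c,d,a)), (-1,(b,d,a,c)), (1,(b,d,c,a)),
    (1,(c,a,b,d)), (-1,(c,a,d,b)), (-1,(c,b,a,d)), (1,(c,b,d,a)), (1,(c,d,a,b)), (-1,(c,d,b,a)),
    (-1,(d,a,b,c)), (1,(d,a,c,b)), (1,(d,b,a,c)), (-1,(d,b,c,a)), (-1,(d,c,a,b)), (1,(d,c,b,a)) ]

/-- The totally antisymmetric symbol ε₄ with value 1 on Λ and vanishing on quadruples
that are not permutations of a quadruple of Λ. -/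
def eps4 (a b c d : Fin 8) : ℝ :=
  (((LambdaT.map signedPerms4).flatten).map (fun p => if p.2 = (a,b,c,d) then p.1 else 0)).sum

/-- Matrix of left multiplication by `e a`: `(Imat a) d c` is the coefficient of `e d` in
`e a * e c`. -/
def Imat (a : Fin 8) : Matrix (Fin 8) (Fin 8) ℝ := Matrix.of fun d c => mulCoef a c d

/-- Octonionic Heisenberg group multiplication on 𝕆 × Im 𝕆 (realized inside 𝕆 × 𝕆):
`(x,t)·(y,s) = (x+y, t+s+2 Im(x ȳ))`. -/
def hmul (p q : Octo × Octo) : Octo × Octo :=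
  (p.1 + q.1, p.2 + q.2 + (2:ℝ) • imO (omul p.1 (conjO q.1)))

/-- Group inverse in the octonionic Heisenberg group. -/
def hinv (p : Octo × Octo) : Octo × Octo := (-p.1, -p.2)

/-- Homogeneous norm ‖(x,t)‖ = (|x|⁴+|t|²)^{1/4}. -/
def hnorm (p : Octo × Octo) : ℝ := ((normSq p.1)^2 + normSq p.2) ^ ((1:ℝ)/4)

/-- The inversion R(x,t) = (−((|x|²e₀ − t)⁻¹)x, −t/(|x|⁴+|t|²)). -/
def Rmap (p : Octo × Octo) : Octo × Octo :=
  (-(omul (oinv (normSq p.1 • e 0 - p.2)) p.1),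
   -(((normSq p.1)^2 + normSq p.2)⁻¹ • p.2))

/-- E^β = I_β for β ∈ {1,…,7}, indexed here by `Fin 7` via `β ↦ β+1`. -/
def E7 (β : Fin 7) : Matrix (Fin 8) (Fin 8) ℝ := Imat β.succ

/-- Octonionic Heisenberg group multiplication in ℝ⁸ × ℝ⁷ coordinates. -/
def hmulC (p q : (Fin 8 → ℝ) × (Fin 7 → ℝ)) : (Fin 8 → ℝ) × (Fin 7 → ℝ) :=
  (p.1 + q.1, fun β => p.2 β + q.2 β + 2 * ∑ a, ∑ b, E7 β a b * p.1 a * q.1 b)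

/-- The left-invariant horizontal vector fields
`X_a = ∂/∂x_a + 2 ∑_{β,b} (E^β)_{ba} x_b ∂/∂t_β`. -/
def Xop (a : Fin 8) (f : ((Fin 8 → ℝ) × (Fin 7 → ℝ)) → ℝ)
    (p : (Fin 8 → ℝ) × (Fin 7 → ℝ)) : ℝ :=
  fderiv ℝ f p ((Pi.single a 1 : Fin 8 → ℝ), (0 : Fin 7 → ℝ))
    + 2 * ∑ β : Fin 7, ∑ b : Fin 8,
        E7 β b a * p.1 b * fderiv ℝ f p ((0 : Fin 8 → ℝ), (Pi.single β 1 : Fin 7 → ℝ))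

/-- ρ(x,t) = |x|⁴ + |t|². -/
def rho (p : (Fin 8 → ℝ) × (Fin 7 → ℝ)) : ℝ :=
  (∑ a, (p.1 a)^2)^2 + ∑ β, (p.2 β)^2

/-- Integer version of `eps`. -/
def epsZ (a b c : Fin 8) : ℤ :=
  ((([(1,2,3),(2,4,6),(4,3,5),(3,6,7),(6,5,1),(5,7,2),(7,1,4)] :
    List (Fin 8 × Fin 8 × Fin 8)).map (fun t =>
    ([(1,(t.1,t.2.1,t.2.2)), (1,(t.2.1,t.2.2,t.1)), (1,(t.2.2,t.1,t.2.1)),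
     (-1,(t.2.1,t.1,t.2.2)), (-1,(t.1,t.2.2,t.2.1)), (-1,(t.2.2,t.2.1,t.1))] :
      List (ℤ × (Fin 8 × Fin 8 × Fin 8))))).flatten.map
        (fun p => if p.2 = (a,b,c) then p.1 else 0)).sum

theorem eps_eq_cast (a b c : Fin 8) : eps a b c = (epsZ a b c : ℝ) := by
  simp only [eps, epsZ, OmegaT, signedPerms3, List.map_cons, List.map_nil, List.flatten_cons,
    List.flatten_nil, List.cons_append, List.nil_append, List.append_nil, List.sum_cons,
    List.sum_nil]
  push_cast
  rfl

set_option maxRecDepth 100000 in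
set_option maxHeartbeats 4000000 in
theorem epsZ_antisymm : ∀ a b c : Fin 8, epsZ a b c = - epsZ a c b := by
  decide +kernel

set_option maxRecDepth 100000 in
theorem epsZ_zero : ∀ a b : Fin 8, epsZ a b 0 = 0 := by
  decide +kernel

theorem E7_antisymm (β : Fin 7) (a b : Fin 8) : E7 β b a = - E7 β a b := by
  have h0 : β.succ ≠ 0 := Fin.succ_ne_zero β
  have h1 := epsZ_antisymm β.succ a b
  have h2 := epsZ_zero β.succ a
  have h3 := epsZ_zero β.succ b
  simp only [E7, Imat, Matrix.of_apply, mulCoef, eps_eq_cast, h0, if_false]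
  generalize β.succ = g at *
  by_cases ha : a = 0
  · by_cases hb : b = 0
    · subst ha hb
      simp [h0.symm]
    · subst ha
      by_cases h : g = b
      · subst h
        simp [h0, h0.symm, hb, h3]
      · simp [hb, h3, h, Ne.symm h, h0.symm]
  · by_cases hb : b = 0
    · subst hb
      by_cases h : g = a
      · subst h
        simp [h0, h0.symm, ha, h2]
      · simp [ha, h2, h, Ne.symm h, h0.symm]
    · simp [ha, hb, h1]

/-- Linear part of the coefficient map of `Xop a`. -/
def Llin (a : Fin 8) : ((Fin 8 → ℝ) × (Fin 7 → ℝ)) →L[ℝ] ((Fin 8 → ℝ) × (Fin 7 → ℝ)) :=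
  LinearMap.toContinuousLinearMap
    { toFun := fun p => (0, fun β => 2 * ∑ b, E7 β b a * p.1 b)
      map_add' := by
        intro p q
        ext i
        · simp
        · simp [mul_add, Finset.sum_add_distrib]
      map_smul' := by
        intro c p
        ext i
        · simp
        · simp [Finset.mul_sum]
          refine Finset.sum_congr rfl fun _ _ => by ring }

theorem Llin_apply (a : Fin 8) (p : (Fin 8 → ℝ) × (Fin 7 → ℝ)) :
    Llin a p = (0, fun β => 2 * ∑ b, E7 β b a * p.1 b) := rfl

/-- The vector field `X_a`. -/
def Vf (a : Fin 8) (p : (Fin 8 → ℝ) × (Fin 7 → ℝ)) : (Fin 8 → ℝ) × (Fin 7 → ℝ) :=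
  (Pi.single a 1, 0) + Llin a p

theorem clm_t (φ : ((Fin 8 → ℝ) × (Fin 7 → ℝ)) →L[ℝ] ℝ) (v : Fin 7 → ℝ) :
    φ (0, v) = ∑ β, v β * φ (0, Pi.single β 1) := by
  have hv : ((0 : Fin 8 → ℝ), v) =
      ∑ β, v β • ((0 : Fin 8 → ℝ), (Pi.single β 1 : Fin 7 → ℝ)) := by
    ext i
    · simp [Prod.fst_sum]
    · simp [Prod.snd_sum, Finset.sum_apply, Pi.single_apply]
  rw [hv, map_sum]
  simp only [map_smul, smul_eq_mul]

theorem Xop_eq (a : Fin 8) (f : ((Fin 8 → ℝ) × (Fin 7 → ℝ)) → ℝ) :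
    Xop a f = fun p => fderiv ℝ f p (Vf a p) := by
  funext p
  rw [Xop, Vf, map_add, Llin_apply, clm_t]
  simp only [Finset.mul_sum, Finset.sum_mul, mul_assoc]

theorem fderiv_Xop (b : Fin 8) (f : ((Fin 8 → ℝ) × (Fin 7 → ℝ)) → ℝ)
    (hf : ContDiff ℝ 2 f) (p w : (Fin 8 → ℝ) × (Fin 7 → ℝ)) :
    fderiv ℝ (Xop b f) p w
      = fderiv ℝ (fderiv ℝ f) p w (Vf b p) + fderiv ℝ f p (Llin b w) := by
  have h1 : DifferentiableAt ℝ (fderiv ℝ f) p :=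
    ((hf.fderiv_right (m := 1) (by norm_num)).differentiable (by norm_num)) p
  have h2 : HasFDerivAt (Vf b) (Llin b) p := (Llin b).hasFDerivAt.const_add _
  rw [Xop_eq, (h1.hasFDerivAt.clm_apply h2).fderiv]
  simp [add_comm]

theorem Llin_Vf (a b : Fin 8) (p : (Fin 8 → ℝ) × (Fin 7 → ℝ)) :
    Llin b (Vf a p) = (0, fun β => 2 * E7 β a b) := by
  simp [Llin_apply, Vf, Pi.single_apply]

/-- [X_a, X_b] f = 4 Σ_{β=1}^{7} (E^β)_{ab} ∂f/∂t_β for C² functions f. -/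
theorem Xop_commutator (a b : Fin 8) (f : ((Fin 8 → ℝ) × (Fin 7 → ℝ)) → ℝ)
    (hf : ContDiff ℝ 2 f) (p : (Fin 8 → ℝ) × (Fin 7 → ℝ)) :
    Xop a (Xop b f) p - Xop b (Xop a f) p
      = 4 * ∑ β : Fin 7,
          E7 β a b * fderiv ℝ f p ((0 : Fin 8 → ℝ), (Pi.single β 1 : Fin 7 → ℝ)) := by
  have hs : fderiv ℝ (fderiv ℝ f) p (Vf a p) (Vf b p)
      = fderiv ℝ (fderiv ℝ f) p (Vf b p) (Vf a p) :=
    (hf.contDiffAt.isSymmSndFDerivAt (by simp)).eq _ _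
  rw [Xop_eq a (Xop b f), Xop_eq b (Xop a f)]
  simp only [fderiv_Xop _ f hf, Llin_Vf]
  rw [hs, clm_t, clm_t _ (fun β => 2 * E7 β b a), add_sub_add_left_eq_sub,
    ← Finset.sum_sub_distrib, Finset.mul_sum]
  refine Finset.sum_congr rfl fun β _ => ?_
  rw [E7_antisymm β a b]
  ring


end OC
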